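/- arXiv:1504.07019 — 3 statements merged into one kernel-verified Lean document; each statement's English description precedes it below -/
import Mathlib

section
/- Let G = (V,E,w) be a connected graph with nonnegative edge weights on n = |V| vertices (n ≥ 3), and suppose G is p-path-separable for some integer p ≥ 1. Then the shortest-path metric space (V, d_G) is β-decomposable with β = O(ln(p ln n)); explicitly, β = (40/ln 2) · ln(4 p log₂ n) suffices. -/
open Set

/-- The weight of a walk in an edge-weighted graph: the sum of the weights of its edges. -/
def walkWeight {V : Type*} {G : SimpleGraph V} (w : Sym2 V → ℝ) {u v : V}
    (p : G.Walk u v) : ℝ :=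
  (p.edges.map w).sum

/-- The shortest-path distance between `u` and `v` computed in the subgraph of `G`
induced on the vertex set `U`, i.e. using only walks all of whose vertices lie in `U`. -/
noncomputable def distIn {V : Type*} (G : SimpleGraph V) (w : Sym2 V → ℝ) (U : Set V)
    (u v : V) : ℝ :=
  sInf {r : ℝ | ∃ p : G.Walk u v, (∀ x ∈ p.support, x ∈ U) ∧ r = walkWeight w p}

/-- The shortest-path metric `d_G` of the edge-weighted graph `(G, w)`. -/
noncomputable def graphDist {V : Type*} (G : SimpleGraph V) (w : Sym2 V → ℝ) (u v : V) : ℝ :=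
  distIn G w Set.univ u v

/-- `P` is the vertex set of a shortest path of the subgraph of `G` induced on `U`:
a path all of whose vertices lie in `U` and whose weight equals the distance (in the
induced subgraph) between its endpoints. -/
def IsShortestPathIn {V : Type*} (G : SimpleGraph V) (w : Sym2 V → ℝ) (U : Set V)
    (P : Set V) : Prop :=
  ∃ (u v : V) (p : G.Walk u v), p.IsPath ∧ (∀ x ∈ p.support, x ∈ U) ∧
    walkWeight w p = distIn G w U u v ∧ P = {x | x ∈ p.support}

/-- `u` is reachable from `v` by a walk whose vertices all lie in `W`. -/
def ReachIn {V : Type*} (G : SimpleGraph V) (W : Set V) (u v : V) : Prop :=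
  ∃ p : G.Walk u v, ∀ x ∈ p.support, x ∈ W

/-- `C` is a connected component (a "flap") of the subgraph of `G` induced on `W`. -/
def IsFlap {V : Type*} (G : SimpleGraph V) (W C : Set V) : Prop :=
  ∃ x ∈ W, C = {y | ReachIn G W x y}

/-- `p`-path-separability of (the subgraph of `G` induced on) a vertex set `U`:
there are vertex sets `P 0, …, P (m-1)` whose union `S` is a separator such that each
`P j` is the union of `pj j` shortest paths of `G_j`, the subgraph induced on
`U \ (P 0 ∪ ⋯ ∪ P (j-1))`, with `∑ j, pj j ≤ p`; moreover every connected component `C`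
of the subgraph induced on `U \ S` has `|C| ≤ |U|/2` and is itself recursively
`p`-path-separable. -/
inductive PathSeparable {V : Type*} (G : SimpleGraph V) (w : Sym2 V → ℝ) (p : ℕ) :
    Set V → Prop
  | intro (U : Set V) (m : ℕ) (P : Fin m → Set V) (pj : Fin m → ℕ)
      (hpaths : ∀ j : Fin m, ∃ Q : Fin (pj j) → Set V, P j = ⋃ i, Q i ∧
        ∀ i, IsShortestPathIn G w (U \ ⋃ (i' : Fin m) (_ : i' < j), P i') (Q i))
      (hsum : ∑ j, pj j ≤ p)
      (hbal : ∀ C : Set V, IsFlap G (U \ ⋃ j, P j) C → 2 * C.ncard ≤ U.ncard)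
      (hrec : ∀ C : Set V, IsFlap G (U \ ⋃ j, P j) C → PathSeparable G w p C) :
      PathSeparable G w p U

/-- `β`-decomposability (Abraham et al.) of the space `X` with distance function `d`:
for every `Δ > 0` there is a probability distribution over partitions of `X` into
clusters of diameter at most `Δ` such that for every `x` and every `0 ≤ γ ≤ 1/100`,
the ball of radius `γΔ` around `x` is contained in the cluster of `x` with probability
at least `2^(-βγ)`. -/
def IsBetaDecomposable {X : Type*} (d : X → X → ℝ) (β : ℝ) : Prop :=
  ∀ Δ : ℝ, 0 < Δ →
    ∃ μ : PMF {P : Set (Set X) // Setoid.IsPartition P},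
      (∀ P ∈ μ.support, ∀ S ∈ P.1, ∀ x ∈ S, ∀ y ∈ S, d x y ≤ Δ) ∧
      ∀ (x : X) (γ : ℝ), 0 ≤ γ → γ ≤ 1 / 100 →
        ENNReal.ofReal ((2 : ℝ) ^ (-(β * γ))) ≤
          μ.toOuterMeasure {P | ∀ S ∈ P.1, x ∈ S → {y | d x y ≤ γ * Δ} ⊆ S}

/-- There is a walk from `u` to `v` inside `W` of weight at most `r`. -/
def WithinIn {V : Type*} (G : SimpleGraph V) (w : Sym2 V → ℝ) (W : Set V) (r : ℝ)
    (u v : V) : Prop :=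
  ∃ p : G.Walk u v, (∀ x ∈ p.support, x ∈ W) ∧ walkWeight w p ≤ r

section Walks

variable {V : Type*} {G : SimpleGraph V} {w : Sym2 V → ℝ}

lemma walkWeight_append {u v x : V} (p : G.Walk u v) (q : G.Walk v x) :
    walkWeight w (p.append q) = walkWeight w p + walkWeight w q := by
  simp [walkWeight, SimpleGraph.Walk.edges_append]

lemma walkWeight_reverse {u v : V} (p : G.Walk u v) :
    walkWeight w p.reverse = walkWeight w p := by
  simp [walkWeight, SimpleGraph.Walk.edges_reverse, List.sum_reverse]

lemma walkWeight_nonneg (hw : ∀ e, 0 ≤ w e) {u v : V} (p : G.Walk u v) :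
    0 ≤ walkWeight w p := by
  apply List.sum_nonneg
  simp only [List.mem_map]
  rintro _ ⟨e, _, rfl⟩
  exact hw e

lemma walkWeight_bypass_le [DecidableEq V] (hw : ∀ e, 0 ≤ w e) {u v : V} (p : G.Walk u v) :
    walkWeight w p.bypass ≤ walkWeight w p := by
  obtain ⟨l, hl, hs⟩ := List.subperm_of_subset p.bypass_isPath.isTrail.edges_nodup
    p.edges_bypass_subset_edges
  unfold walkWeight
  rw [← (hl.map w).sum_eq]
  apply (hs.map w).sum_le_sum
  simp only [List.mem_map]
  rintro _ ⟨e, _, rfl⟩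
  exact hw e

lemma distIn_le (hw : ∀ e, 0 ≤ w e) {W : Set V} {u v : V} (p : G.Walk u v)
    (hp : ∀ x ∈ p.support, x ∈ W) : distIn G w W u v ≤ walkWeight w p := by
  refine csInf_le ⟨0, ?_⟩ ⟨p, hp, rfl⟩
  rintro _ ⟨q, _, rfl⟩
  exact walkWeight_nonneg hw q

lemma exists_walkWeight_eq_distIn [Finite V] (hw : ∀ e, 0 ≤ w e) {W : Set V} {u v : V}
    (h : ReachIn G W u v) :
    ∃ p : G.Walk u v, (∀ x ∈ p.support, x ∈ W) ∧ walkWeight w p = distIn G w W u v := by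
  classical
  have := Fintype.ofFinite V
  let T : Set (G.Path u v) := {p | ∀ x ∈ p.1.support, x ∈ W}
  obtain ⟨q, hq⟩ := h
  have hbyp : ∀ q : G.Walk u v, (∀ x ∈ q.support, x ∈ W) → q.toPath ∈ T :=
    fun q hq x hx => hq x (q.support_bypass_subset_support hx)
  obtain ⟨p, hp, hmin⟩ := T.toFinite.exists_minimalFor (fun p => walkWeight w p.1) T
    ⟨_, hbyp q hq⟩
  refine ⟨p.1, hp, le_antisymm ?_ (distIn_le hw _ hp)⟩
  refine le_csInf ⟨walkWeight w q, q, hq, rfl⟩ ?_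
  rintro _ ⟨r, hr, rfl⟩
  have h1 := walkWeight_bypass_le hw r
  rcases le_total (walkWeight w p.1) (walkWeight w r.toPath.1) with h | h
  · exact h.trans h1
  · exact (hmin (hbyp r hr) h).trans h1

lemma WithinIn.mono {W W' : Set V} {r r' : ℝ} {u v : V} (h : WithinIn G w W r u v)
    (hW : W ⊆ W') (hr : r ≤ r') : WithinIn G w W' r' u v :=
  let ⟨p, hp, hpr⟩ := h
  ⟨p, fun x hx => hW (hp x hx), hpr.trans hr⟩

lemma WithinIn.symm {W : Set V} {r : ℝ} {u v : V} (h : WithinIn G w W r u v) :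
    WithinIn G w W r v u :=
  let ⟨p, hp, hpr⟩ := h
  ⟨p.reverse, by simpa using hp, by rwa [walkWeight_reverse]⟩

lemma WithinIn.trans {W : Set V} {r s : ℝ} {u v x : V} (h : WithinIn G w W r u v)
    (h' : WithinIn G w W s v x) : WithinIn G w W (r + s) u x := by
  obtain ⟨p, hp, hpr⟩ := h
  obtain ⟨q, hq, hqr⟩ := h'
  refine ⟨p.append q, fun y hy => ?_, by rw [walkWeight_append]; linarith⟩
  rcases SimpleGraph.Walk.mem_support_append_iff _ _ |>.1 hy with h | h
  exacts [hp y h, hq y h]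

lemma WithinIn.reachIn {W : Set V} {r : ℝ} {u v : V} (h : WithinIn G w W r u v) :
    ReachIn G W u v :=
  let ⟨p, hp, _⟩ := h
  ⟨p, hp⟩

lemma WithinIn.distIn_le (hw : ∀ e, 0 ≤ w e) {W : Set V} {r : ℝ} {u v : V}
    (h : WithinIn G w W r u v) : distIn G w W u v ≤ r :=
  let ⟨p, hp, hpr⟩ := h
  (_root_.distIn_le hw p hp).trans hpr

lemma ReachIn.withinIn [Finite V] (hw : ∀ e, 0 ≤ w e) {W : Set V} {r : ℝ} {u v : V}
    (h : ReachIn G W u v) (hr : distIn G w W u v ≤ r) : WithinIn G w W r u v :=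
  let ⟨p, hp, hpe⟩ := exists_walkWeight_eq_distIn hw h
  ⟨p, hp, hpe.trans_le hr⟩

/-- Balls of the shortest-path metric are internally connected by short walks. -/
lemma withinIn_ball [Finite V] (hw : ∀ e, 0 ≤ w e) (hconn : G.Connected) {x y : V} {r : ℝ}
    (hy : graphDist G w x y ≤ r) : WithinIn G w {y | graphDist G w x y ≤ r} r x y := by
  classical
  obtain ⟨p, -, hpr⟩ : WithinIn G w univ r x y :=
    ReachIn.withinIn hw ⟨(hconn x y).some, fun _ _ => mem_univ _⟩ hy
  refine ⟨p, fun z hz => ?_, hpr⟩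
  have h1 : graphDist G w x z ≤ walkWeight w (p.takeUntil z hz) :=
    distIn_le hw _ fun _ _ => mem_univ _
  have h2 := walkWeight_append (w := w) (p.takeUntil z hz) (p.dropUntil z hz)
  rw [p.take_spec hz] at h2
  have h3 := walkWeight_nonneg hw (p.dropUntil z hz)
  show graphDist G w x z ≤ r
  linarith

/-- A shortest path embeds isometrically into the line. -/
lemma IsShortestPathIn.exists_pos [Finite V] (hw : ∀ e, 0 ≤ w e) {W Q : Set V}
    (h : IsShortestPathIn G w W Q) :
    ∃ pos : V → ℝ, ∀ s ∈ Q, ∀ t ∈ Q, WithinIn G w W |pos s - pos t| s t ∧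
      ∀ r, WithinIn G w W r s t → |pos s - pos t| ≤ r := by
  classical
  obtain ⟨u, v, p, -, hpW, hpd, rfl⟩ := h
  have key : ∀ s ∈ p.support, ∀ t ∈ p.support,
      (∃ (p₁ : G.Walk u s) (p₂ : G.Walk s t) (p₃ : G.Walk t v),
        p = p₁.append (p₂.append p₃)) ∨
      (∃ (p₁ : G.Walk u t) (p₂ : G.Walk t s) (p₃ : G.Walk s v),
        p = p₁.append (p₂.append p₃)) := by
    intro s hs t ht
    have ht' := ht
    rw [← p.take_spec hs, SimpleGraph.Walk.mem_support_append_iff] at ht'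
    rcases ht' with h | h
    · right
      refine ⟨(p.takeUntil s hs).takeUntil t h, (p.takeUntil s hs).dropUntil t h,
        p.dropUntil s hs, ?_⟩
      rw [SimpleGraph.Walk.append_assoc, SimpleGraph.Walk.take_spec,
        SimpleGraph.Walk.take_spec]
    · left
      refine ⟨p.takeUntil s hs, (p.dropUntil s hs).takeUntil t h,
        (p.dropUntil s hs).dropUntil t h, ?_⟩
      rw [SimpleGraph.Walk.take_spec, SimpleGraph.Walk.take_spec]
  have ordered : ∀ s t : V, ∀ (p₁ : G.Walk u s) (p₂ : G.Walk s t) (p₃ : G.Walk t v),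
      p = p₁.append (p₂.append p₃) →
      (∀ x ∈ p₂.support, x ∈ W) ∧
        distIn G w W u t - distIn G w W u s = walkWeight w p₂ ∧
        ∀ r, WithinIn G w W r s t → walkWeight w p₂ ≤ r := by
    rintro s t p₁ p₂ p₃ rfl
    simp only [SimpleGraph.Walk.mem_support_append_iff] at hpW
    have h1 : ∀ x ∈ p₁.support, x ∈ W := fun x hx => hpW x (.inl hx)
    have h2 : ∀ x ∈ p₂.support, x ∈ W := fun x hx => hpW x (.inr (.inl hx))
    have h3 : ∀ x ∈ p₃.support, x ∈ W := fun x hx => hpW x (.inr (.inr hx))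
    simp only [walkWeight_append] at hpd
    have w1 : WithinIn G w W (walkWeight w p₁) u s := ⟨p₁, h1, le_rfl⟩
    have w2 : WithinIn G w W (walkWeight w p₂) s t := ⟨p₂, h2, le_rfl⟩
    have w3 : WithinIn G w W (walkWeight w p₃) t v := ⟨p₃, h3, le_rfl⟩
    have ds := w1.reachIn.withinIn hw le_rfl
    have dt := (w1.trans w2).reachIn.withinIn hw le_rfl
    have e1 := w1.distIn_le hw
    have e2 := (w1.trans w2).distIn_le hw
    have e3 := (ds.trans (w2.trans w3)).distIn_le hw
    have e4 := (dt.trans w3).distIn_le hw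
    refine ⟨h2, by linarith, fun r hr => ?_⟩
    have e5 := (w1.trans (hr.trans w3)).distIn_le hw
    linarith
  refine ⟨distIn G w W u, fun s hs t ht => ?_⟩
  rcases key s hs t ht with ⟨p₁, p₂, p₃, hp⟩ | ⟨p₁, p₂, p₃, hp⟩
  · obtain ⟨h1, h2, h3⟩ := ordered _ _ p₁ p₂ p₃ hp
    rw [abs_sub_comm, h2, abs_of_nonneg (walkWeight_nonneg hw _)]
    exact ⟨⟨p₂, h1, le_rfl⟩, h3⟩
  · obtain ⟨h1, h2, h3⟩ := ordered _ _ p₁ p₂ p₃ hp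
    rw [h2, abs_of_nonneg (walkWeight_nonneg hw _)]
    exact ⟨WithinIn.symm ⟨p₂, h1, le_rfl⟩, fun r hr => h3 r hr.symm⟩

open Classical in
/-- A shortest path has a net of which at most six points are near any given vertex. -/
lemma IsShortestPathIn.exists_net [Finite V] (hw : ∀ e, 0 ≤ w e) {W Q : Set V}
    (h : IsShortestPathIn G w W Q) {δ R : ℝ} (hδ : 0 < δ) (hR : 2 * R < 5 * δ) :
    ∃ L : List V, (∀ z ∈ Q, ∃ t ∈ L, WithinIn G w W δ t z) ∧
      ∀ x, L.countP (fun t => WithinIn G w W R t x) ≤ 6 := by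
  have := Fintype.ofFinite V
  obtain ⟨pos, hpos⟩ := h.exists_pos hw
  let k : V → ℤ := fun z => ⌊pos z / δ⌋
  obtain ⟨N, hNQ, hN⟩ := Set.exists_subset_bijOn Q k
  refine ⟨N.toFinset.toList, fun z hz => ?_, fun x => ?_⟩
  · obtain ⟨t, ht, htz⟩ := hN.surjOn ⟨z, hz, rfl⟩
    refine ⟨t, by simpa using ht, (hpos t (hNQ ht) z hz).1.mono subset_rfl ?_⟩
    have := Int.abs_sub_lt_one_of_floor_eq_floor htz
    rw [← sub_div, abs_div, abs_of_pos hδ, div_lt_one hδ] at this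
    exact this.le
  · have hc : N.toFinset.toList.countP (fun t => WithinIn G w W R t x) =
        (N.toFinset.filter fun t => WithinIn G w W R t x).card := by
      rw [List.countP_eq_length_filter, ← List.toFinset_card_of_nodup
        ((Finset.nodup_toList _).filter _), List.toFinset_filter, Finset.toList_toFinset]
      simp
    rw [hc]
    set F := N.toFinset.filter fun t => WithinIn G w W R t x with hF
    rcases F.eq_empty_or_nonempty with h0 | hne
    · simp [h0]
    obtain ⟨s, hs, hmin⟩ := F.exists_min_image k hne
    have hmem : ∀ t ∈ F, t ∈ N ∧ WithinIn G w W R t x := fun t ht => by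
      simpa [hF] using ht
    have hmaps : ∀ t ∈ F, k t ∈ Finset.Icc (k s) (k s + 5) := by
      intro t ht
      refine Finset.mem_Icc.2 ⟨hmin t ht, ?_⟩
      have h1 := (hpos t (hNQ (hmem t ht).1) s (hNQ (hmem s hs).1)).2 _
        ((hmem t ht).2.trans (hmem s hs).2.symm)
      have h2 : pos t / δ ≤ pos s / δ + 5 := by
        rw [div_add' _ _ _ hδ.ne']
        gcongr
        linarith [le_abs_self (pos t - pos s)]
      calc k t ≤ ⌊pos s / δ + 5⌋ := Int.floor_le_floor h2
        _ = k s + 5 := by exact_mod_cast Int.floor_add_natCast (pos s / δ) 5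
    have := Finset.card_le_card_of_injOn k hmaps
      (hN.injOn.mono fun t ht => (hmem t ht).1)
    rw [Int.card_Icc] at this
    omega

end Walks

section RandomSets

open MeasureTheory

variable {V : Type*} [Finite V]

/-- The random superlevel set `{v | u ≤ f v}` with `u` uniform in `(0, 1]`. -/
lemma exists_pmf_superlevel (f : V → ℝ) :
    ∃ ρ : PMF (Set V),
      (∀ A ∈ ρ.support, ∀ v, (v ∈ A → 0 < f v) ∧ (1 ≤ f v → v ∈ A)) ∧
      (∀ (B : Set V) (l : ℝ), l ≤ 1 → (∀ y ∈ B, l ≤ f y) →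
        ENNReal.ofReal l ≤ ρ.toOuterMeasure {A | B ⊆ A}) ∧
      (∀ (B : Set V) (h : ℝ), 0 ≤ h → (∀ y ∈ B, f y ≤ h) →
        ENNReal.ofReal (1 - h) ≤ ρ.toOuterMeasure {A | Disjoint B A}) := by
  let _ : MeasurableSpace (Set V) := ⊤
  have : MeasurableSingletonClass (Set V) := ⟨fun _ => trivial⟩
  have hdisc : ∀ s : Set (Set V), MeasurableSet s := fun _ => trivial
  let ν : Measure ℝ := volume.restrict (Ioc 0 1)
  have hν : IsProbabilityMeasure ν := ⟨by simp [ν]⟩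
  let F : ℝ → Set V := fun u => {v | u ≤ f v}
  have hF : Measurable F := by
    refine measurable_to_countable' fun A => ?_
    have : F ⁻¹' {A} = ⋂ v, {u | u ≤ f v ↔ v ∈ A} := by
      ext u
      simp only [mem_preimage, mem_singleton_iff, mem_iInter, mem_ofPred_eq, Set.ext_iff, F]
    rw [this]
    refine MeasurableSet.iInter fun v => ?_
    by_cases hv : v ∈ A
    · convert measurableSet_Iic (a := f v) using 1
      ext u
      simp [hv]
    · convert measurableSet_Ioi (a := f v) using 1
      ext u
      simp [hv]
  have hP : IsProbabilityMeasure (ν.map F) := Measure.isProbabilityMeasure_map hF.aemeasurable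
  have hmeas : ∀ s : Set (Set V), (ν.map F).toPMF.toOuterMeasure s = ν (F ⁻¹' s) := by
    intro s
    rw [← PMF.toMeasure_apply_eq_toOuterMeasure_apply _ (hdisc s), Measure.toPMF_toMeasure,
      Measure.map_apply hF (hdisc s)]
  refine ⟨(ν.map F).toPMF, fun A hA v => ?_, fun B l hl hB => ?_, fun B h hh hB => ?_⟩
  · rw [PMF.mem_support_iff, Measure.toPMF_apply, Measure.map_apply hF (hdisc _)] at hA
    obtain ⟨u, hu, hu01⟩ : (F ⁻¹' {A} ∩ Ioc 0 1).Nonempty := by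
      apply nonempty_of_measure_ne_zero (μ := volume)
      rwa [Measure.restrict_apply (hF (hdisc _))] at hA
    rw [mem_preimage, mem_singleton_iff] at hu
    subst hu
    exact ⟨fun h => hu01.1.trans_le h, fun h => hu01.2.trans h⟩
  · rw [hmeas, Measure.restrict_apply (hF (hdisc _))]
    calc ENNReal.ofReal l = volume (Ioc 0 l) := by simp
      _ ≤ _ := measure_mono fun u hu => by
        refine ⟨fun y hy => hu.2.trans (hB y hy), hu.1, hu.2.trans hl⟩
  · rw [hmeas, Measure.restrict_apply (hF (hdisc _))]
    calc ENNReal.ofReal (1 - h) = volume (Ioc h 1) := by simp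
      _ ≤ _ := measure_mono fun u hu => by
        refine ⟨Set.disjoint_left.2 fun y hy hyA => ((hB y hy).trans_lt hu.1).not_ge hyA,
          hh.trans_lt hu.1, hu.2⟩

open Classical in
/-- Sequential random clustering: a vertex is labelled by the first of the independent random
superlevel sets that contains it. -/
lemma exists_pmf_labelling (fs : List (V → ℝ)) (hfs : ∀ f ∈ fs, ∀ v, 0 ≤ f v ∧ f v ≤ 1) :
    ∃ μ : PMF (V → ℕ),
      (∀ lab ∈ μ.support, ∀ v,
        (∀ f, fs[lab v]? = some f → 0 < f v) ∧ ((∃ f ∈ fs, f v = 1) → lab v < fs.length)) ∧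
      ∀ (B : Set V) (x : V) (q κ : ℝ) (l₁ : List (V → ℝ)) (f : V → ℝ) (l₂ : List (V → ℝ)),
        x ∈ B → q ≤ 1 → 0 ≤ κ → fs = l₁ ++ f :: l₂ → (∀ y ∈ B, f y = 1) →
        (∀ g ∈ l₁, ∀ y ∈ B, ∀ z ∈ B, q * g z - κ ≤ g y) →
        ENNReal.ofReal (q - κ * l₁.countP (fun g => ∃ y ∈ B, 0 < g y)) ≤
          μ.toOuterMeasure {lab | ∀ y ∈ B, lab y = lab x} := by
  induction fs with
  | nil =>
    refine ⟨PMF.pure fun _ => 0, by simp, ?_⟩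
    intro B x q κ l₁ f l₂ _ _ _ h
    simp at h
  | cons f fs ih =>
    obtain ⟨μ, hμ1, hμ2⟩ := ih fun g hg => hfs g (List.mem_cons_of_mem _ hg)
    obtain ⟨ρ, hρ1, hρ2, hρ3⟩ := exists_pmf_superlevel f
    let ext : Set V → (V → ℕ) → V → ℕ := fun A lab v => if v ∈ A then 0 else lab v + 1
    refine ⟨ρ.bind fun A => μ.map (ext A), ?_, ?_⟩
    · intro lab hlab v
      simp only [PMF.mem_support_bind_iff, PMF.mem_support_map_iff] at hlab
      obtain ⟨A, hA, lab', hlab', rfl⟩ := hlab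
      by_cases hv : v ∈ A
      · simpa [ext, hv] using (hρ1 A hA v).1 hv
      · have hfv : f v ≠ 1 := fun h => hv ((hρ1 A hA v).2 h.ge)
        simpa [ext, hv, hfv] using hμ1 lab' hlab' v
    · intro B x q κ l₁ g l₂ hx hq hκ heq hg hl₁
      set pad : Set (V → ℕ) := {lab | ∀ y ∈ B, lab y = lab x} with hpad
      have key : ρ.toOuterMeasure {A | B ⊆ A} +
          ρ.toOuterMeasure {A | Disjoint B A} * μ.toOuterMeasure pad ≤
          (ρ.bind fun A => μ.map (ext A)).toOuterMeasure pad := by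
        rw [PMF.toOuterMeasure_bind_apply, PMF.toOuterMeasure_apply ρ,
          PMF.toOuterMeasure_apply ρ, ← ENNReal.tsum_mul_right, ← ENNReal.tsum_add]
        refine ENNReal.tsum_le_tsum fun A => ?_
        rw [PMF.toOuterMeasure_map_apply]
        by_cases h1 : B ⊆ A
        · have h2 : ¬ Disjoint B A := fun h => Set.disjoint_left.1 h hx (h1 hx)
          have h3 : ext A ⁻¹' pad = univ := by
            refine eq_univ_of_forall fun lab => ?_
            simp only [hpad, mem_preimage, mem_ofPred_eq, ext, h1 hx, if_true]
            intro y hy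
            simp [h1 hy]
          have h4 : μ.toOuterMeasure univ = 1 :=
            (PMF.toOuterMeasure_apply_eq_one_iff μ _).2 (subset_univ _)
          simp [h1, h2, h3, h4]
        · by_cases h2 : Disjoint B A
          · have h3 : pad ⊆ ext A ⁻¹' pad := by
              intro lab hlab y hy
              simp [ext, Set.disjoint_left.1 h2 hy, Set.disjoint_left.1 h2 hx, hlab y hy]
            simp only [indicator, mem_ofPred_eq, h1, h2, if_true, if_false, zero_add]
            gcongr
          · simp [h1, h2]
      refine le_trans ?_ key
      rcases l₁ with _ | ⟨f', l₁⟩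
      · simp only [List.nil_append, List.cons.injEq] at heq
        obtain ⟨rfl, rfl⟩ := heq
        refine le_add_right (le_trans (ENNReal.ofReal_le_ofReal ?_)
          (hρ2 B 1 le_rfl fun y hy => (hg y hy).ge))
        simpa using hq
      · simp only [List.cons_append, List.cons.injEq] at heq
        obtain ⟨rfl, rfl⟩ := heq
        have ih' := hμ2 B x q κ l₁ g l₂ hx hq hκ rfl hg
          fun g hg => hl₁ g (List.mem_cons_of_mem _ hg)
        have hcond := hl₁ f List.mem_cons_self
        have hf01 := hfs f List.mem_cons_self
        set N := l₁.countP (fun g => ∃ y ∈ B, 0 < g y) with hN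
        obtain ⟨z, hz, hmax⟩ := B.toFinite.exists_maximalFor f B ⟨x, hx⟩
        have hmax' : ∀ y ∈ B, f y ≤ f z := fun y hy => by
          rcases le_total (f y) (f z) with h | h
          exacts [h, hmax hy h]
        by_cases hpos : ∃ y ∈ B, 0 < f y
        · have hc : (f :: l₁).countP (fun g => ∃ y ∈ B, 0 < g y) = N + 1 := by
            rw [List.countP_cons_of_pos (by simpa using hpos)]
          rw [hc]
          have hle : q * f z - κ ≤ 1 := (hcond z hz z hz).trans (hf01 z).2
          calc _ ≤ ENNReal.ofReal ((q * f z - κ) + (1 - f z) * (q - κ * N)) := by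
                apply ENNReal.ofReal_le_ofReal
                push_cast
                have : 0 ≤ f z * (κ * N) :=
                  mul_nonneg (hf01 z).1 (mul_nonneg hκ (Nat.cast_nonneg _))
                nlinarith
            _ ≤ ENNReal.ofReal (q * f z - κ) + ENNReal.ofReal ((1 - f z) * (q - κ * N)) :=
                ENNReal.ofReal_add_le
            _ ≤ _ := by
                rw [ENNReal.ofReal_mul (by linarith [(hf01 z).2])]
                gcongr
                · exact hρ2 B _ hle fun y hy => hcond y hy z hz
                · exact hρ3 B _ (hf01 z).1 hmax'
        · have hc : (f :: l₁).countP (fun g => ∃ y ∈ B, 0 < g y) = N := by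
            rw [List.countP_cons_of_neg (by simpa using hpos)]
          rw [hc]
          push Not at hpos
          have h1 := hρ3 B 0 le_rfl hpos
          calc _ ≤ μ.toOuterMeasure pad := ih'
            _ = ENNReal.ofReal (1 - 0) * μ.toOuterMeasure pad := by simp
            _ ≤ ρ.toOuterMeasure {A | Disjoint B A} * μ.toOuterMeasure pad := by gcongr
            _ ≤ _ := le_add_self

end RandomSets

section Centres

variable {V : Type*} {G : SimpleGraph V} {w : Sym2 V → ℝ}

lemma ReachIn.trans_symm {W : Set V} {x y z : V} (h : ReachIn G W x z) (h' : ReachIn G W y z) :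
    ReachIn G W x y := by
  obtain ⟨p, hp⟩ := h
  obtain ⟨q, hq⟩ := h'
  have hp' : WithinIn G (fun _ => 0) W _ x z := ⟨p, hp, le_rfl⟩
  have hq' : WithinIn G (fun _ => 0) W _ y z := ⟨q, hq, le_rfl⟩
  exact (hp'.trans hq'.symm).reachIn

lemma IsFlap.subset {W C : Set V} (h : IsFlap G W C) : C ⊆ W := by
  obtain ⟨x, -, rfl⟩ := h
  rintro y ⟨p, hp⟩
  exact hp y p.end_mem_support

lemma IsFlap.eq_of_mem {W C C' : Set V} (h : IsFlap G W C) (h' : IsFlap G W C') {z : V}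
    (hz : z ∈ C) (hz' : z ∈ C') : C = C' := by
  obtain ⟨x, hx, rfl⟩ := h
  obtain ⟨x', hx', rfl⟩ := h'
  have hxx' : ReachIn G W x x' := ReachIn.trans_symm hz hz'
  have refl : ∀ y ∈ W, ReachIn G W y y := fun y hy => ⟨.nil, by simpa using hy⟩
  have symm : ∀ {a b}, b ∈ W → ReachIn G W a b → ReachIn G W b a :=
    fun hb h => ReachIn.trans_symm (refl _ hb) h
  ext y
  constructor
  · intro hy
    have hyW : y ∈ W := hy.elim fun p hp => hp y p.end_mem_support
    exact ReachIn.trans_symm (symm hx' hxx') (symm hyW hy)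
  · intro hy
    have hyW : y ∈ W := hy.elim fun p hp => hp y p.end_mem_support
    exact ReachIn.trans_symm hxx' (symm hyW hy)

open Classical in
/-- In the list `L` of centres `(t, W)`, some centre is within `δ + ρ` of `x`, with `B` inside its
subgraph `W`, and before it `B` is never split by a subgraph and at most `N` centres are within
`R` of `x`. -/
def HasNearCentre (G : SimpleGraph V) (w : Sym2 V → ℝ) (δ R ρ : ℝ) (B : Set V) (x : V)
    (L : List (V × Set V)) (N : ℕ) : Prop :=
  ∃ l₁ c l₂, L = l₁ ++ c :: l₂ ∧ B ⊆ c.2 ∧ WithinIn G w c.2 (δ + ρ) c.1 x ∧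
    (∀ c ∈ l₁, B ⊆ c.2 ∨ Disjoint B c.2) ∧
    l₁.countP (fun c => B ⊆ c.2 ∧ WithinIn G w c.2 R c.1 x) ≤ N

lemma HasNearCentre.append_right {δ R ρ : ℝ} {B : Set V} {x : V} {L : List (V × Set V)}
    {N : ℕ} (h : HasNearCentre G w δ R ρ B x L N) (L' : List (V × Set V)) :
    HasNearCentre G w δ R ρ B x (L ++ L') N := by
  obtain ⟨l₁, c, l₂, rfl, h⟩ := h
  exact ⟨l₁, c, l₂ ++ L', by simp, h⟩

lemma HasNearCentre.mono {δ R ρ : ℝ} {B : Set V} {x : V} {L : List (V × Set V)}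
    {N N' : ℕ} (h : HasNearCentre G w δ R ρ B x L N) (hN : N ≤ N') :
    HasNearCentre G w δ R ρ B x L N' := by
  obtain ⟨l₁, c, l₂, h1, h2, h3, h4, h5⟩ := h
  exact ⟨l₁, c, l₂, h1, h2, h3, h4, h5.trans hN⟩

open Classical in
lemma HasNearCentre.append_left {δ R ρ : ℝ} {B : Set V} {x : V} {L L' : List (V × Set V)}
    {N N' : ℕ} (h : HasNearCentre G w δ R ρ B x L N)
    (hL' : ∀ c ∈ L', B ⊆ c.2 ∨ Disjoint B c.2)
    (hN' : L'.countP (fun c => B ⊆ c.2 ∧ WithinIn G w c.2 R c.1 x) ≤ N') :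
    HasNearCentre G w δ R ρ B x (L' ++ L) (N' + N) := by
  obtain ⟨l₁, c, l₂, rfl, h2, h3, h4, h5⟩ := h
  refine ⟨L' ++ l₁, c, l₂, by simp, h2, h3, ?_, ?_⟩
  · intro c hc
    rcases List.mem_append.1 hc with hc | hc
    exacts [hL' c hc, h4 c hc]
  · rw [List.countP_append]
    exact Nat.add_le_add hN' h5

open Classical in
lemma exists_centres_of_shortestPaths [Finite V] (hw : ∀ e, 0 ≤ w e) {δ R : ℝ} (hδ : 0 < δ)
    (hR : 2 * R < 5 * δ) {W : Set V} {k : ℕ} {Q : Fin k → Set V}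
    (hQ : ∀ i, IsShortestPathIn G w W (Q i)) :
    ∃ L : List (V × Set V), (∀ c ∈ L, c.2 = W) ∧
      (∀ z ∈ ⋃ i, Q i, ∃ c ∈ L, WithinIn G w W δ c.1 z) ∧
      ∀ x, L.countP (fun c => WithinIn G w W R c.1 x) ≤ 6 * k := by
  choose N hN1 hN2 using fun i => (hQ i).exists_net hw hδ hR
  refine ⟨(List.finRange k).flatMap fun i => (N i).map fun t => (t, W), ?_, ?_, ?_⟩
  · simp only [List.mem_flatMap, List.mem_map]
    rintro _ ⟨i, -, t, -, rfl⟩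
    rfl
  · intro z hz
    obtain ⟨i, hi⟩ := mem_iUnion.1 hz
    obtain ⟨t, ht, htz⟩ := hN1 i z hi
    exact ⟨(t, W), List.mem_flatMap.2 ⟨i, List.mem_finRange i, List.mem_map.2 ⟨t, ht, rfl⟩⟩, htz⟩
  · intro x
    rw [List.countP_flatMap]
    refine (List.sum_le_card_nsmul _ 6 ?_).trans (by simp [mul_comm])
    simp only [List.mem_map]
    rintro _ ⟨i, -, rfl⟩
    simpa [List.countP_map, Function.comp_def] using hN2 i x

lemma PathSeparable.exists_centres [Finite V] (hw : ∀ e, 0 ≤ w e) {δ R : ℝ} (hδ : 0 < δ)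
    (hR : 2 * R < 5 * δ) {p : ℕ} {U : Set V} (hps : PathSeparable G w p U) :
    ∃ L : List (V × Set V), (∀ c ∈ L, c.2 ⊆ U) ∧
      ∀ (B : Set V) (x : V) (ρ : ℝ), x ∈ B → B ⊆ U → (∀ y ∈ B, WithinIn G w B ρ x y) →
        HasNearCentre G w δ R ρ B x L (6 * p * (Nat.log 2 U.ncard + 1)) := by
  classical
  induction hps with
  | intro U m P pj hpaths hsum hbal _ ih =>
  choose! Lf hLf1 hLf2 using ih
  have chain : ∀ k ≤ m, ∃ L : List (V × Set V), (∀ c ∈ L, c.2 ⊆ U) ∧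
      ∀ (B : Set V) (x : V) (ρ : ℝ), x ∈ B → B ⊆ U → (∀ y ∈ B, WithinIn G w B ρ x y) →
        (∀ j : Fin m, j.1 < k → Disjoint B (P j)) →
        HasNearCentre G w δ R ρ B x L
          (6 * ∑ j : Fin m with k ≤ j.1, pj j + 6 * p * Nat.log 2 U.ncard) := by
    intro k hk
    induction hk using Nat.decreasingInduction with
    | self =>
      let flaps := {C : Set V | IsFlap G (U \ ⋃ j, P j) C}
      have hfin : flaps.Finite := toFinite _
      refine ⟨hfin.toFinset.toList.flatMap Lf, ?_, ?_⟩
      · intro c hc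
        obtain ⟨C, hC, hc⟩ := List.mem_flatMap.1 hc
        have hC' : IsFlap G (U \ ⋃ j, P j) C := by simpa [flaps] using hC
        exact (hLf1 C hC' c hc).trans (hC'.subset.trans sdiff_subset)
      · intro B x ρ hx hBU hB hdisj
        have hBW : B ⊆ U \ ⋃ j, P j := by
          refine fun y hy => ⟨hBU hy, fun hyP => ?_⟩
          obtain ⟨j, hj⟩ := mem_iUnion.1 hyP
          exact Set.disjoint_left.1 (hdisj j j.2) hy hj
        obtain ⟨C, hC, hBC⟩ : ∃ C, IsFlap G (U \ ⋃ j, P j) C ∧ B ⊆ C :=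
          ⟨_, ⟨x, hBW hx, rfl⟩, fun y hy => ((hB y hy).mono hBW le_rfl).reachIn⟩
        obtain ⟨s, t, hst, hs⟩ := List.eq_append_cons_of_mem
          (show C ∈ hfin.toFinset.toList by simpa [flaps] using hC)
        rw [hst, List.flatMap_append, List.flatMap_cons]
        have hlog : Nat.log 2 C.ncard + 1 ≤ Nat.log 2 U.ncard := by
          have hpos : C.ncard ≠ 0 := ((ncard_pos C.toFinite).2 ⟨x, hBC hx⟩).ne'
          rw [← Nat.log_mul_base one_lt_two hpos]
          exact Nat.log_mono_right ((mul_comm _ _).trans_le (hbal C hC))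
        have hs_disj : ∀ c ∈ s.flatMap Lf, Disjoint B c.2 := by
          intro c hc
          obtain ⟨C', hC's, hc⟩ := List.mem_flatMap.1 hc
          have hC' : IsFlap G (U \ ⋃ j, P j) C' := by
            have : C' ∈ hfin.toFinset.toList := hst ▸ List.mem_append_left _ hC's
            simpa [flaps] using this
          refine Set.disjoint_left.2 fun y hy hyc => hs ?_
          rwa [hC.eq_of_mem hC' (hBC hy) (hLf1 C' hC' c hc hyc)]
        refine (((hLf2 C hC B x ρ hx hBC hB).append_right _).append_left (N' := 0)
          (fun c hc => .inr (hs_disj c hc)) ?_).mono ?_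
        · rw [Nat.le_zero, List.countP_eq_zero]
          intro c hc
          have h1 := Set.disjoint_left.1 (hs_disj c hc) hx
          simpa using fun h : B ⊆ c.2 => (h1 (h hx)).elim
        · calc _ = 6 * p * (Nat.log 2 C.ncard + 1) := zero_add _
            _ ≤ 6 * p * Nat.log 2 U.ncard := Nat.mul_le_mul_left _ hlog
            _ ≤ _ := Nat.le_add_left _ _
    | of_succ k hk ih =>
      obtain ⟨L, hL1, hL2⟩ := ih
      let j₀ : Fin m := ⟨k, hk⟩
      obtain ⟨Q, hPQ, hQ⟩ := hpaths j₀
      set W := U \ ⋃ (i' : Fin m) (_ : i' < j₀), P i' with hW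
      obtain ⟨L₀, h01, h02, h03⟩ := exists_centres_of_shortestPaths hw hδ hR hQ
      refine ⟨L₀ ++ L, ?_, ?_⟩
      · intro c hc
        rcases List.mem_append.1 hc with hc | hc
        · rw [h01 c hc]
          exact sdiff_subset
        · exact hL1 c hc
      · intro B x ρ hx hBU hB hdisj
        have hBW : B ⊆ W := by
          refine fun y hy => ⟨hBU hy, fun hyP => ?_⟩
          simp only [mem_iUnion] at hyP
          obtain ⟨j, hj, hyj⟩ := hyP
          exact Set.disjoint_left.1 (hdisj j hj) hy hyj
        have hsplit : ∑ j : Fin m with k ≤ j.1, pj j =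
            pj j₀ + ∑ j : Fin m with k + 1 ≤ j.1, pj j := by
          have : (Finset.univ.filter fun j : Fin m => k ≤ j.1) =
              insert j₀ (Finset.univ.filter fun j : Fin m => k + 1 ≤ j.1) := by
            ext j
            simp only [Finset.mem_filter, Finset.mem_univ, true_and, Finset.mem_insert,
              Fin.ext_iff, j₀]
            omega
          rw [this, Finset.sum_insert (by simp [j₀])]
        have hcount : L₀.countP (fun c => B ⊆ c.2 ∧ WithinIn G w c.2 R c.1 x) ≤
            6 * pj j₀ := by
          refine le_trans (List.countP_mono_left fun c hc h => ?_) (h03 x)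
          simp only [decide_eq_true_eq] at h ⊢
          rw [← h01 c hc]
          exact h.2
        have hsub : ∀ c ∈ L₀, B ⊆ c.2 := fun c hc => by rwa [h01 c hc]
        by_cases hBP : Disjoint B (P j₀)
        · refine ((hL2 B x ρ hx hBU hB fun j hj => ?_).append_left
            (fun c hc => .inl (hsub c hc)) hcount).mono ?_
          · rcases Nat.lt_succ_iff_lt_or_eq.1 hj with h | h
            · exact hdisj j h
            · rwa [show j = j₀ from Fin.ext h]
          · rw [hsplit]
            exact le_of_eq (by ring)
        · obtain ⟨z, hzB, hzP⟩ := Set.not_disjoint_iff.1 hBP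
          rw [hPQ] at hzP
          obtain ⟨c, hc, hcz⟩ := h02 z hzP
          obtain ⟨l₁, l₂, rfl⟩ := List.append_of_mem hc
          refine HasNearCentre.append_right
            ⟨l₁, c, l₂, rfl, hsub c hc, ?_, fun c hc => .inl (hsub c (by simp [hc])), ?_⟩ _
          · rw [h01 c hc]
            exact hcz.trans ((hB z hzB).mono hBW le_rfl).symm
          · rw [List.countP_append] at hcount
            rw [hsplit, Nat.mul_add, Nat.add_assoc]
            exact (Nat.le_add_right _ _).trans (hcount.trans (Nat.le_add_right _ _))
  obtain ⟨L, hL1, hL2⟩ := chain 0 (Nat.zero_le m)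
  refine ⟨L, hL1, fun B x ρ hx hBU hB => (hL2 B x ρ hx hBU hB (by simp)).mono ?_⟩
  simp only [Nat.zero_le, Finset.filter_true]
  nlinarith

end Centres

/-- The tail at `s` of `a` plus an exponential variable of rate `lam` truncated at its quantile of
tail `ε`, clipped to `[0, 1]`. -/
noncomputable def truncExpTail (lam a ε s : ℝ) : ℝ :=
  max 0 (min 1 ((Real.exp (-(lam * (s - a))) - ε) / (1 - ε)))

section TruncExpTail

variable {lam a ε : ℝ}

lemma truncExpTail_nonneg (s : ℝ) : 0 ≤ truncExpTail lam a ε s := le_max_left _ _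

lemma truncExpTail_le_one (s : ℝ) : truncExpTail lam a ε s ≤ 1 :=
  max_le zero_le_one (min_le_left _ _)

lemma truncExpTail_antitone (hlam : 0 ≤ lam) (hε : ε < 1) : Antitone (truncExpTail lam a ε) := by
  intro s t hst
  unfold truncExpTail
  have : 0 < 1 - ε := by linarith
  gcongr

lemma truncExpTail_eq_one (hlam : 0 ≤ lam) (hε : ε < 1) {s : ℝ} (hs : s ≤ a) :
    truncExpTail lam a ε s = 1 := by
  have h : 1 ≤ (Real.exp (-(lam * (s - a))) - ε) / (1 - ε) := by
    rw [le_div_iff₀ (by linarith)]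
    have : 1 ≤ Real.exp (-(lam * (s - a))) := Real.one_le_exp (by nlinarith)
    linarith
  simp [truncExpTail, min_eq_left h]

lemma truncExpTail_pos (hlam : 0 ≤ lam) {b : ℝ} (hε : Real.exp (-(lam * (b - a))) < 1) {s : ℝ}
    (hs : 0 < truncExpTail lam a (Real.exp (-(lam * (b - a)))) s) : s ≤ b := by
  by_contra! h
  refine hs.ne' (max_eq_left ((min_le_right _ _).trans ?_))
  apply div_nonpos_of_nonpos_of_nonneg _ (by linarith)
  rw [sub_nonpos, Real.exp_le_exp]
  nlinarith

lemma truncExpTail_add (hε0 : 0 ≤ ε) (hε : ε < 1) {q τ : ℝ} (hq : q = Real.exp (-(lam * τ)))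
    (hq1 : q ≤ 1) (s : ℝ) :
    q * truncExpTail lam a ε s - (1 - q) * ε / (1 - ε) ≤ truncExpTail lam a ε (s + τ) := by
  have hε' : 0 < 1 - ε := by linarith
  have hκ : 0 ≤ (1 - q) * ε / (1 - ε) :=
    div_nonneg (mul_nonneg (by linarith) hε0) hε'.le
  have hq0 : 0 ≤ q := hq ▸ (Real.exp_pos _).le
  have hshift : (Real.exp (-(lam * (s + τ - a))) - ε) / (1 - ε) =
      q * ((Real.exp (-(lam * (s - a))) - ε) / (1 - ε)) - (1 - q) * ε / (1 - ε) := by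
    have : Real.exp (-(lam * (s + τ - a))) = q * Real.exp (-(lam * (s - a))) := by
      rw [hq, ← Real.exp_add]
      ring_nf
    rw [this]
    ring
  unfold truncExpTail
  rw [hshift]
  set u := (Real.exp (-(lam * (s - a))) - ε) / (1 - ε)
  set κ := (1 - q) * ε / (1 - ε)
  rcases le_total (min 1 u) 0 with h | h
  · rw [max_eq_left h]
    exact le_max_of_le_left (by linarith)
  · rw [max_eq_right h]
    refine le_max_of_le_right (le_min ?_ ?_)
    · nlinarith [min_le_left 1 u]
    · nlinarith [min_le_right 1 u]

end TruncExpTail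

lemma six_mul_le_logb {n : ℕ} (hn : 3 ≤ n) :
    6 * ((Nat.log 2 n : ℝ) + 1) ≤ 10 * Real.logb 2 n ∧ (3 / 2 : ℝ) ≤ Real.logb 2 n := by
  have hn' : (3 : ℝ) ≤ n := by exact_mod_cast hn
  have h1 : (3 / 2 : ℝ) ≤ Real.logb 2 n := by
    have h : Real.logb 2 8 = 3 := by
      rw [show (8 : ℝ) = 2 ^ (3 : ℝ) by norm_num]
      exact Real.logb_rpow (by norm_num) (by norm_num)
    have h2 : Real.logb 2 ((n : ℝ) ^ 2) = 2 * Real.logb 2 n := by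
      exact_mod_cast Real.logb_pow 2 (n : ℝ) 2
    have h3 : Real.logb 2 8 ≤ Real.logb 2 ((n : ℝ) ^ 2) :=
      Real.logb_le_logb_of_le (by norm_num) (by norm_num) (by nlinarith)
    linarith
  have h2 : (Nat.log 2 n : ℝ) ≤ Real.logb 2 n := by exact_mod_cast Real.natLog_le_logb n 2
  exact ⟨by linarith, h1⟩

/-- The failure probabilities add up to a negligible amount. -/
lemma sq_le_sub_of_exp {M γ N : ℝ} (hM : 6 ≤ M) (hγ : 0 ≤ γ) (hγ' : γ ≤ 1 / 100)
    (hN : N ≤ 5 / 2 * M) {q ε : ℝ} (hq : q = Real.exp (-(20 * γ * Real.log M)))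
    (hε : ε = Real.exp (-(12 / 5 * Real.log M))) :
    q ^ 2 ≤ q - (1 - q) * ε / (1 - ε) * N := by
  have hlog : 1 ≤ Real.log M := by
    rw [Real.le_log_iff_exp_le (by linarith)]
    linarith [Real.exp_one_lt_d9]
  have hq1 : q ≤ 1 := by
    rw [hq, Real.exp_le_one_iff]
    nlinarith [mul_nonneg hγ (zero_le_one.trans hlog)]
  have hε0 : 0 < ε := hε ▸ Real.exp_pos _
  have hε1 : ε < 1 := by
    rw [hε, Real.exp_lt_one_iff]
    linarith
  have key : ε * N ≤ q * (1 - ε) := by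
    set r := Real.exp (-(1 / 5 * Real.log M)) with hr
    set t := Real.exp (-(6 / 5 * Real.log M)) with ht
    have hr0 : 0 < r := Real.exp_pos _
    have hrq : r ≤ q := by
      rw [hq, hr, Real.exp_le_exp]
      nlinarith
    have hrM : M * ε = r * t := by
      rw [hε, hr, ht, ← Real.exp_add]
      nth_rewrite 1 [← Real.exp_log (show 0 < M by linarith)]
      rw [← Real.exp_add]
      ring_nf
    have htM : M * t ≤ 1 := by
      nth_rewrite 1 [← Real.exp_log (show 0 < M by linarith)]
      rw [ht, ← Real.exp_add, Real.exp_le_one_iff]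
      linarith
    have ht0 : 0 < t := Real.exp_pos _
    have ht6 : t ≤ 1 / 6 := by nlinarith
    have hεt : ε ≤ t := by
      rw [hε, ht, Real.exp_le_exp]
      linarith
    calc ε * N ≤ ε * (5 / 2 * M) := by gcongr
      _ = r * (5 / 2 * t) := by linear_combination 5 / 2 * hrM
      _ ≤ r * (1 - ε) := mul_le_mul_of_nonneg_left (by linarith) hr0.le
      _ ≤ q * (1 - ε) := mul_le_mul_of_nonneg_right hrq (by linarith)
  have h1 : (1 - q) * ε / (1 - ε) * N ≤ (1 - q) * q := by
    rw [div_mul_eq_mul_div, div_le_iff₀ (by linarith)]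
    nlinarith [mul_le_mul_of_nonneg_left key (sub_nonneg.2 hq1)]
  linarith [sq q]

/-- **Main theorem.** Every connected `p`-path-separable graph on `n ≥ 3` vertices with
nonnegative edge weights is `β`-decomposable with `β = (40/ln 2) · ln(4 p log₂ n)
= O(ln (p ln n))`. -/
theorem pathSeparable_isBetaDecomposable {V : Type*} [Fintype V]
    (G : SimpleGraph V) (w : Sym2 V → ℝ) (hw : ∀ e, 0 ≤ w e)
    (hconn : G.Connected) (hn : 3 ≤ Fintype.card V)
    (p : ℕ) (hp : 1 ≤ p) (hps : PathSeparable G w p Set.univ) :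
    IsBetaDecomposable (graphDist G w)
      ((40 / Real.log 2) *
        Real.log (4 * (p : ℝ) * Real.logb 2 (Fintype.card V))) := by
  classical
  intro Δ hΔ
  set n := Fintype.card V with hnV
  set M := 4 * (p : ℝ) * Real.logb 2 n with hM
  obtain ⟨hlogN, hlog⟩ := six_mul_le_logb hn
  have hp' : (1 : ℝ) ≤ p := by exact_mod_cast hp
  have hM6 : 6 ≤ M := by nlinarith
  have hlogM : 0 < Real.log M := Real.log_pos (by linarith)
  obtain ⟨L, -, hL⟩ := hps.exists_centres hw (δ := 6 / 25 * Δ) (R := 51 / 100 * Δ)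
    (by linarith) (by linarith)
  set lam := 10 * Real.log M / Δ with hlam
  set a := 13 / 50 * Δ with ha
  set b := 1 / 2 * Δ with hb
  set ε := Real.exp (-(lam * (b - a))) with hε
  have hlam0 : 0 < lam := by positivity
  have hε0 : 0 < ε := Real.exp_pos _
  have hεM : ε = Real.exp (-(12 / 5 * Real.log M)) := by
    rw [hε, hlam, ha, hb]
    congr 2
    field_simp
    ring
  have hε1 : ε < 1 := by
    rw [hεM, Real.exp_lt_one_iff]
    linarith
  let S : V × Set V → V → ℝ := fun c v =>
    if ReachIn G c.2 c.1 v then truncExpTail lam a ε (distIn G w c.2 c.1 v) else 0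
  have hS01 : ∀ c v, 0 ≤ S c v ∧ S c v ≤ 1 := by
    intro c v
    by_cases h : ReachIn G c.2 c.1 v
    · simp only [S, h, if_true]
      exact ⟨truncExpTail_nonneg _, truncExpTail_le_one _⟩
    · simp [S, h]
  have hSpos : ∀ c v, 0 < S c v → WithinIn G w c.2 b c.1 v := by
    intro c v h
    by_cases hr : ReachIn G c.2 c.1 v
    · simp only [S, hr, if_true] at h
      exact hr.withinIn hw (truncExpTail_pos hlam0.le hε1 h)
    · simp [S, hr] at h
  have hSone : ∀ c v, WithinIn G w c.2 a c.1 v → S c v = 1 := by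
    intro c v h
    simp only [S, h.reachIn, if_true]
    exact truncExpTail_eq_one hlam0.le hε1 (h.distIn_le hw)
  obtain ⟨μ, hμ1, hμ2⟩ := exists_pmf_labelling (L.map S) (by
    simp only [List.mem_map]
    rintro _ ⟨c, -, rfl⟩
    exact hS01 c)
  refine ⟨μ.map fun lab => ⟨(Setoid.ker lab).classes, Setoid.isPartition_classes _⟩, ?_, ?_⟩
  · intro P hP C hC x hx y hy
    rw [PMF.mem_support_map_iff] at hP
    obtain ⟨lab, hlab, rfl⟩ := hP
    obtain ⟨z, rfl⟩ := hC
    have hxy : lab x = lab y := Eq.trans hx (Eq.symm hy)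
    have hcov : ∃ f ∈ L.map S, f x = 1 := by
      obtain ⟨l₁, c, l₂, rfl, -, hc, -⟩ := hL {y | graphDist G w x y ≤ 0} x 0
        (distIn_le hw .nil fun _ _ => mem_univ _) (subset_univ _)
        fun y hy => withinIn_ball hw hconn hy
      exact ⟨S c, by simp, hSone c x (hc.mono subset_rfl (by linarith))⟩
    have hlt := (hμ1 lab hlab x).2 hcov
    have hlt' : lab x < L.length := by simpa using hlt
    have hget : (L.map S)[lab x]? = some (S L[lab x]) := by simp [hlt']
    have h1 := hSpos _ _ ((hμ1 lab hlab x).1 _ hget)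
    have h2 := hSpos _ _ ((hμ1 lab hlab y).1 _ (by rw [← hxy]; exact hget))
    have h3 := ((h1.symm.trans h2).mono (subset_univ _) (by linarith : b + b ≤ Δ)).distIn_le hw
    exact h3
  · intro x γ hγ hγ'
    set B := {y | graphDist G w x y ≤ γ * Δ} with hB
    have hγΔ0 : 0 ≤ γ * Δ := by positivity
    have hγΔ : γ * Δ ≤ 1 / 100 * Δ := by gcongr
    have hxB : x ∈ B := (distIn_le hw .nil fun _ _ => mem_univ _).trans hγΔ0
    have hball : ∀ y ∈ B, WithinIn G w B (γ * Δ) x y :=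
      fun y hy => withinIn_ball hw hconn hy
    obtain ⟨l₁, c, l₂, rfl, hcB, hcx, hdisj, hcount⟩ := hL B x (γ * Δ) hxB (subset_univ _) hball
    set q := Real.exp (-(20 * γ * Real.log M)) with hq
    have hqlam : q = Real.exp (-(lam * (2 * (γ * Δ)))) := by
      rw [hq, hlam]
      congr 2
      field_simp
      ring
    have hq1 : q ≤ 1 := by
      rw [hq, Real.exp_le_one_iff, neg_nonpos]
      positivity
    set κ := (1 - q) * ε / (1 - ε) with hκ
    have hκ0 : 0 ≤ κ := div_nonneg (mul_nonneg (by linarith) hε0.le) (by linarith)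
    have hpad := hμ2 B x q κ (l₁.map S) (S c) (l₂.map S) hxB hq1 hκ0 (by simp)
      (fun y hy => hSone c y
        ((hcx.trans ((hball y hy).mono hcB le_rfl)).mono subset_rfl (by linarith))) (by
        simp only [List.mem_map]
        rintro _ ⟨c', hc', rfl⟩ y hy z hz
        by_cases hr : ReachIn G c'.2 c'.1 z
        · have hsub : B ⊆ c'.2 := (hdisj c' hc').resolve_right fun h => by
            obtain ⟨r, hr⟩ := hr
            exact Set.disjoint_left.1 h hz (hr z r.end_mem_support)
          have hzy := ((hr.withinIn hw le_rfl).trans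
            (((hball z hz).symm.trans (hball y hy)).mono hsub le_rfl))
          simp only [S, hr, hzy.reachIn, if_true]
          refine (truncExpTail_add hε0.le hε1 hqlam hq1 _).trans
            (truncExpTail_antitone hlam0.le hε1 ?_)
          linarith [hzy.distIn_le hw]
        · have : S c' z = 0 := by simp [S, hr]
          rw [this]
          linarith [(hS01 c' y).1])
    obtain ⟨K, hK, hpadK⟩ : ∃ K : ℕ, K ≤ 6 * p * (Nat.log 2 n + 1) ∧
        ENNReal.ofReal (q - κ * K) ≤
          μ.toOuterMeasure {lab | ∀ y ∈ B, lab y = lab x} := by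
      refine ⟨_, ?_, hpad⟩
      have hcard : (univ : Set V).ncard = n := by
        rw [ncard_univ, Nat.card_eq_fintype_card]
      rw [List.countP_map, ← hcard]
      refine le_trans (List.countP_mono_left fun c' hc' h => ?_) hcount
      simp only [Function.comp_apply, decide_eq_true_eq] at h ⊢
      obtain ⟨y, hy, hpos⟩ := h
      have hw' := hSpos c' y hpos
      have hsub : B ⊆ c'.2 := (hdisj c' hc').resolve_right fun h => by
        obtain ⟨r, hr⟩ := hw'.reachIn
        exact Set.disjoint_left.1 h hy (hr y r.end_mem_support)
      exact ⟨hsub, (hw'.trans ((hball y hy).mono hsub le_rfl).symm).mono subset_rfl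
        (by linarith)⟩
    have hfin := sq_le_sub_of_exp hM6 hγ hγ' (N := K) (by
        calc (K : ℝ) ≤ ((6 * p * (Nat.log 2 n + 1) : ℕ) : ℝ) := by exact_mod_cast hK
          _ = p * (6 * ((Nat.log 2 n : ℝ) + 1)) := by push_cast; ring
          _ ≤ p * (10 * Real.logb 2 n) := by gcongr
          _ = 5 / 2 * M := by rw [hM]; ring) hq hεM
    have htarget : (2 : ℝ) ^ (-(40 / Real.log 2 * Real.log M * γ)) = q ^ 2 := by
      have hl2 : Real.log 2 ≠ 0 := (Real.log_pos one_lt_two).ne'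
      rw [Real.rpow_def_of_pos two_pos, hq, ← Real.exp_nat_mul]
      congr 1
      field_simp
      ring
    rw [htarget]
    refine (ENNReal.ofReal_le_ofReal hfin).trans (hpadK.trans ?_)
    rw [PMF.toOuterMeasure_map_apply]
    refine μ.toOuterMeasure.mono fun lab hlab => ?_
    rintro C ⟨z, rfl⟩ hxz y hy
    exact Eq.trans (hlab y hy) hxz
end

section
/- Let Δ > 0, let k > 1 be a real number, let γ ≥ 0, let λ = Δ/(10 ln k), and let R be a random variable with distribution texp_{[Δ/4, 2Δ/5]}(λ). Then for all real a, b with Δ/4 ≤ a ≤ b ≤ 2Δ/5 and b − a ≤ 2γΔ, one has Pr[a ≤ R ≤ b] ≤ (k^{3/2}/(k^{3/2} − 1)) · e^{−(a − Δ/4)/λ} · (1 − e^{−20γ ln k}); in particular, Pr[a ≤ R ≤ b] ≤ (1 + 1/(k^{3/2} − 1)) · (1 − e^{−20γ ln k}). -/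
open MeasureTheory Real

/-- The truncated exponential distribution `texp_[α,β](λ)`: the probability measure on
`[α, β]` with density `x ↦ e^{-x/λ} / (λ(e^{-α/λ} - e^{-β/λ}))`. -/
noncomputable def texp (α β lam : ℝ) : Measure ℝ :=
  (volume.restrict (Set.Icc α β)).withDensity fun x =>
    ENNReal.ofReal (Real.exp (-x / lam) /
      (lam * (Real.exp (-α / lam) - Real.exp (-β / lam))))

/-- The mass that `texp α β lam` gives to a subinterval of `[α, β]`. -/
theorem texp_apply_Icc {α β lam a b : ℝ} (hlam : 0 < lam) (hαβ : α < β)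
    (ha : α ≤ a) (hab : a ≤ b) (hb : b ≤ β) :
    texp α β lam (Set.Icc a b) =
      ENNReal.ofReal ((Real.exp (-a / lam) - Real.exp (-b / lam)) /
        (Real.exp (-α / lam) - Real.exp (-β / lam))) := by
  have hD : 0 < Real.exp (-α / lam) - Real.exp (-β / lam) := by
    rw [sub_pos, Real.exp_lt_exp]
    gcongr
  set D := Real.exp (-α / lam) - Real.exp (-β / lam)
  have hcont : Continuous fun x : ℝ => Real.exp (-x / lam) / (lam * D) := by fun_prop
  have hderiv : ∀ x ∈ Set.uIcc a b, HasDerivAt (fun x : ℝ => -(Real.exp (-x / lam) / D))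
      (Real.exp (-x / lam) / (lam * D)) x := by
    intro x _
    refine ((((hasDerivAt_neg x).div_const lam).exp.div_const D).neg).congr_deriv ?_
    field_simp
  rw [texp, withDensity_apply _ measurableSet_Icc, Measure.restrict_restrict measurableSet_Icc,
    Set.inter_eq_left.mpr (Set.Icc_subset_Icc ha hb),
    ← ofReal_integral_eq_lintegral_ofReal hcont.integrableOn_Icc
      (Filter.Eventually.of_forall fun x => by positivity),
    integral_Icc_eq_integral_Ioc, ← intervalIntegral.integral_of_le hab,
    intervalIntegral.integral_eq_sub_of_hasDerivAt hderiv (hcont.intervalIntegrable a b)]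
  congr 1
  ring

/-- The ratio giving the mass of `[a, b]` under `texp α β lam`, normalised by its left endpoint. -/
theorem exp_sub_exp_div_exp_sub_exp (α β lam a b : ℝ) :
    (Real.exp (-a / lam) - Real.exp (-b / lam)) / (Real.exp (-α / lam) - Real.exp (-β / lam)) =
      Real.exp (-(a - α) / lam) * (1 - Real.exp (-((b - a) / lam))) /
        (1 - Real.exp (-((β - α) / lam))) := by
  have factor (x y : ℝ) : Real.exp (-x / lam) - Real.exp (-y / lam) =
      Real.exp (-x / lam) * (1 - Real.exp (-((y - x) / lam))) := by
    rw [mul_sub, mul_one, ← Real.exp_add]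
    ring_nf
  have shift : Real.exp (-a / lam) = Real.exp (-α / lam) * Real.exp (-(a - α) / lam) := by
    rw [← Real.exp_add]
    ring_nf
  rw [factor a b, factor α β, shift, mul_assoc, mul_div_mul_left _ _ (Real.exp_ne_zero _)]

/-- Let `R ∼ texp_[Δ/4, 2Δ/5](λ)` with `λ = Δ/(10 ln k)`, `k > 1`. For
`Δ/4 ≤ a ≤ b ≤ 2Δ/5` with `b - a ≤ 2γΔ`,
`Pr[a ≤ R ≤ b] ≤ (k^{3/2}/(k^{3/2}-1)) · e^{-(a-Δ/4)/λ} · (1 - e^{-20γ ln k})`;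
in particular `Pr[a ≤ R ≤ b] ≤ (1 + 1/(k^{3/2}-1)) · (1 - e^{-20γ ln k})`. -/
theorem texp_prob_Icc_le {Ω : Type*} [MeasurableSpace Ω] (μ : Measure Ω)
    [IsProbabilityMeasure μ] (Δ k γ lam : ℝ) (hΔ : 0 < Δ) (hk : 1 < k) (hγ : 0 ≤ γ)
    (hlam : lam = Δ / (10 * Real.log k))
    (R : Ω → ℝ) (hR : Measurable R) (hdist : μ.map R = texp (Δ / 4) (2 * Δ / 5) lam)
    (a b : ℝ) (ha : Δ / 4 ≤ a) (hab : a ≤ b) (hb : b ≤ 2 * Δ / 5)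
    (hba : b - a ≤ 2 * γ * Δ) :
    μ {ω | a ≤ R ω ∧ R ω ≤ b} ≤
      ENNReal.ofReal ((k ^ ((3 : ℝ) / 2) / (k ^ ((3 : ℝ) / 2) - 1)) *
        Real.exp (-(a - Δ / 4) / lam) * (1 - Real.exp (-(20 * γ * Real.log k)))) ∧
    μ {ω | a ≤ R ω ∧ R ω ≤ b} ≤
      ENNReal.ofReal ((1 + 1 / (k ^ ((3 : ℝ) / 2) - 1)) *
        (1 - Real.exp (-(20 * γ * Real.log k)))) := by
  have hlog : 0 < Real.log k := Real.log_pos hk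
  have hlam_pos : 0 < lam := by rw [hlam]; positivity
  have hK : 1 < k ^ ((3 : ℝ) / 2) := Real.one_lt_rpow hk (by norm_num)
  have hnorm : Real.exp (-((2 * Δ / 5 - Δ / 4) / lam)) = (k ^ ((3 : ℝ) / 2))⁻¹ := by
    rw [Real.exp_neg, Real.rpow_def_of_pos (by linarith), hlam]
    congr 2
    field_simp
    norm_num
  have hlen : (b - a) / lam ≤ 20 * γ * Real.log k := by
    rw [div_le_iff₀ hlam_pos, hlam]
    refine hba.trans_eq ?_
    field_simp
    ring
  have hprob : μ {ω | a ≤ R ω ∧ R ω ≤ b} = texp (Δ / 4) (2 * Δ / 5) lam (Set.Icc a b) := by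
    rw [← hdist, Measure.map_apply hR measurableSet_Icc]
    rfl
  set K := k ^ ((3 : ℝ) / 2)
  have hK' : 0 < K - 1 := sub_pos.mpr hK
  have hKfac : 1 + 1 / (K - 1) = K / (K - 1) := by
    field_simp
    ring
  have htail : 0 ≤ 1 - Real.exp (-(20 * γ * Real.log k)) := by
    rw [sub_nonneg, Real.exp_le_one_iff, neg_nonpos]
    positivity
  have hfirst : μ {ω | a ≤ R ω ∧ R ω ≤ b} ≤ ENNReal.ofReal (K / (K - 1) *
      Real.exp (-(a - Δ / 4) / lam) * (1 - Real.exp (-(20 * γ * Real.log k)))) := by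
    rw [hprob, texp_apply_Icc hlam_pos (by linarith) ha hab hb, exp_sub_exp_div_exp_sub_exp, hnorm]
    refine ENNReal.ofReal_le_ofReal ?_
    calc Real.exp (-(a - Δ / 4) / lam) * (1 - Real.exp (-((b - a) / lam))) / (1 - K⁻¹)
        = K / (K - 1) * Real.exp (-(a - Δ / 4) / lam) * (1 - Real.exp (-((b - a) / lam))) := by
          have : K / (K - 1) = (1 - K⁻¹)⁻¹ := by
            rw [← one_div_div, sub_div, div_self (by linarith), one_div, one_div]
          rw [this]
          ring
      _ ≤ _ := by gcongr
  refine ⟨hfirst, hfirst.trans (ENNReal.ofReal_le_ofReal ?_)⟩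
  rw [hKfac]
  refine mul_le_mul_of_nonneg_right (mul_le_of_le_one_right (by positivity) ?_) htail
  rw [Real.exp_le_one_iff]
  exact div_nonpos_of_nonpos_of_nonneg (by linarith) hlam_pos.le
end

section
/- Let k ≥ 2 be an integer, write K = k^{3/2} and C = K/(K − 1), and let ε ≥ 0. Suppose q_1, …, q_k are real numbers and a_1, …, a_k ∈ [K^{−1}, 1] satisfy: q_k ≤ C · a_k · ε, and for every 1 ≤ j < k, q_j ≤ C · a_j · ε + C · (1 − a_j) · q_{j+1}. Then for every 1 ≤ j ≤ k, q_j ≤ (1 + (k − j + 1)/(K − 1)) · ε. -/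
/-- The abstract backward-induction recurrence underlying Lemma 1: if `K = k^{3/2}`,
`C = K/(K-1)`, `ε ≥ 0`, the `a j` lie in `[K⁻¹, 1]`, `q k ≤ C·a k·ε`, and
`q j ≤ C·a j·ε + C·(1 - a j)·q (j+1)` for `1 ≤ j < k`, then
`q j ≤ (1 + (k - j + 1)/(K - 1))·ε` for every `1 ≤ j ≤ k`. -/
theorem backward_induction_recurrence (k : ℕ) (hk : 2 ≤ k) (K C : ℝ)
    (hK : K = (k : ℝ) ^ ((3 : ℝ) / 2)) (hC : C = K / (K - 1))
    (ε : ℝ) (hε : 0 ≤ ε) (q a : ℕ → ℝ)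
    (ha : ∀ j, 1 ≤ j → j ≤ k → K⁻¹ ≤ a j ∧ a j ≤ 1)
    (hqk : q k ≤ C * a k * ε)
    (hrec : ∀ j, 1 ≤ j → j < k → q j ≤ C * a j * ε + C * (1 - a j) * q (j + 1)) :
    ∀ j, 1 ≤ j → j ≤ k → q j ≤ (1 + ((k : ℝ) - (j : ℝ) + 1) / (K - 1)) * ε := by
  have hK1 : 1 < K := by
    rw [hK]
    exact Real.one_lt_rpow (by exact_mod_cast hk) (by norm_num)
  have hd : 0 < K - 1 := sub_pos.mpr hK1
  have hC1 : C = 1 + 1 / (K - 1) := by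
    rw [hC]
    field_simp
    ring
  have hC0 : 0 < C := by rw [hC1]; positivity
  have hCK : C * (1 - K⁻¹) = 1 := by
    rw [hC]
    field_simp
  intro j hj hjk
  induction hjk using Nat.decreasingInduction with
  | self =>
    have h := mul_le_mul_of_nonneg_right
      (mul_le_mul_of_nonneg_left (ha k hj le_rfl).2 hC0.le) hε
    calc q k ≤ C * a k * ε := hqk
      _ ≤ C * 1 * ε := h
      _ = _ := by rw [hC1]; ring
  | of_succ j hlt ih =>
    obtain ⟨hal, hau⟩ := ha j hj hlt.le
    have ih := ih (by omega)
    push_cast at ih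
    have hfac : 0 ≤ C * (1 - a j) := mul_nonneg hC0.le (sub_nonneg.mpr hau)
    have hfac_le : C * (1 - a j) ≤ 1 :=
      (mul_le_mul_of_nonneg_left (sub_le_sub_left hal 1) hC0.le).trans_eq hCK
    have hm : 0 ≤ ((k : ℝ) - j) / (K - 1) * ε := by
      have : (j : ℝ) ≤ k := by exact_mod_cast hlt.le
      exact mul_nonneg (div_nonneg (sub_nonneg.mpr this) hd.le) hε
    calc q j ≤ C * a j * ε + C * (1 - a j) * q (j + 1) := hrec j hj hlt
      _ ≤ C * a j * ε + C * (1 - a j) * ((1 + ((k : ℝ) - (j + 1) + 1) / (K - 1)) * ε) := by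
        gcongr
      _ = C * ε + C * (1 - a j) * (((k : ℝ) - j) / (K - 1) * ε) := by ring
      _ ≤ C * ε + 1 * (((k : ℝ) - j) / (K - 1) * ε) := by gcongr
      _ = _ := by rw [hC1]; ring
end
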